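/- Let (N, v) be a CE-game with Δ i > 0 for every i ∈ N^E, v(N) > 0, and ∑_{i∈N^E} Q i < mq; let φ be the NEA allocation and e(S, φ) := ∑_{i∈S} φ i − v(S) the excess. Let D^N ⊆ N^C be a maximizer of G^N over subsets of N^C and assume D^N ≠ ∅. Let α : D^N → ℝ be nonnegative weights with ∑_{j∈D^N} α j > 0. For ρ ≥ 0 define the proportional essential rate allocation φ^ρ by φ^ρ_i := (1 − ρ) * φ_i for i ∈ N^E, φ^ρ_i := (α_i / ∑_{j∈D^N} α_j) * ρ * v(N) for i ∈ D^N, and φ^ρ_i := 0 otherwise. If 0 ≤ ρ ≤ min over proper coalitions S ⊊ N with S^E ≠ ∅ of e(S, φ)/(∑_{i∈S} φ i), then φ^ρ is in the core of (N, v): ∑_{i∈N} φ^ρ_i = v(N) and ∑_{i∈S} φ^ρ_i ≥ v(S) for every S ⊆ N. -/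

import Mathlib

open Finset

noncomputable section

variable {ι : Type*}

/-- Full capacity margin `Δ i`. -/
def Dm (Q c : ι → ℝ) (p : ℝ) (i : ι) : ℝ := Q i * p - c i

/-- Under-supply adjusted margin `δ i`. -/
def dm (Q c : ι → ℝ) (p ru : ℝ) (i : ι) : ℝ := Q i * (p + ru) - c i

/-- Essential players of a coalition `S`. -/
def SE [DecidableEq ι] (Q c : ι → ℝ) (p : ℝ) (S : Finset ι) : Finset ι :=
  S.filter fun i => 0 ≤ Dm Q c p i

/-- Potential players of a coalition `S`. -/
def SP [DecidableEq ι] (Q c : ι → ℝ) (p ru : ℝ) (S : Finset ι) : Finset ι :=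
  S.filter fun i => 0 ≤ dm Q c p ru i

/-- Complementary players of a coalition `S`. -/
def SC [DecidableEq ι] (Q c : ι → ℝ) (p ru : ℝ) (S : Finset ι) : Finset ι :=
  SP Q c p ru S \ SE Q c p S

/-- Profit `π(R)` of an exporter set `R` (with `π(∅) = 0`). -/
def piR [DecidableEq ι] (Q c : ι → ℝ) (p ru mq : ℝ) (R : Finset ι) : ℝ :=
  if R = ∅ then 0 else (∑ i ∈ R, Dm Q c p i) - max (mq - ∑ i ∈ R, Q i) 0 * ru

/-- The CE-game: `v(S)` is the maximum of `π` over all subsets of `S`. -/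
def vG [DecidableEq ι] (Q c : ι → ℝ) (p ru mq : ℝ) (S : Finset ι) : ℝ :=
  S.powerset.sup' (Finset.powerset_nonempty S) (piR Q c p ru mq)

/-- `G^S(D)`: contribution of a set `D` of complementary players in coalition `S`. -/
def GS [DecidableEq ι] (Q c : ι → ℝ) (p ru mq : ℝ) (S D : Finset ι) : ℝ :=
  (∑ i ∈ D, Dm Q c p i) + min (mq - ∑ i ∈ SE Q c p S, Q i) (∑ i ∈ D, Q i) * ru

/-- The NEA (Non-essential Exporter Altruistic) allocation. -/
def NEA [DecidableEq ι] (Q c : ι → ℝ) (p ru mq : ℝ) (N : Finset ι) (i : ι) : ℝ :=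
  if i ∈ SE Q c p N then (Dm Q c p i / ∑ j ∈ SE Q c p N, Dm Q c p j) * vG Q c p ru mq N
  else 0

/-- Excess of a coalition `S` with respect to the NEA allocation of the game on `N`. -/
def exc [DecidableEq ι] (Q c : ι → ℝ) (p ru mq : ℝ) (N S : Finset ι) : ℝ :=
  (∑ i ∈ S, NEA Q c p ru mq N i) - vG Q c p ru mq S

lemma vG_nonpos_of_SE_eq_empty [DecidableEq ι] {Q c : ι → ℝ} {p ru mq : ℝ} (hru : 0 ≤ ru)
    {S : Finset ι} (hS : SE Q c p S = ∅) : vG Q c p ru mq S ≤ 0 := by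
  refine Finset.sup'_le _ _ fun R hR => ?_
  unfold piR
  split_ifs with h
  · exact le_rfl
  · have hΔ : ∑ i ∈ R, Dm Q c p i ≤ 0 := Finset.sum_nonpos fun i hi => by
      by_contra! hi'
      have : i ∈ SE Q c p S := Finset.mem_filter.2 ⟨Finset.mem_powerset.1 hR hi, hi'.le⟩
      simp [hS] at this
    have := mul_nonneg (le_max_right (mq - ∑ i ∈ R, Q i) 0) hru
    linarith

lemma sum_NEA [DecidableEq ι] {Q c : ι → ℝ} {p ru mq : ℝ} {N : Finset ι}
    (hΔ : ∑ j ∈ SE Q c p N, Dm Q c p j ≠ 0) :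
    ∑ i ∈ N, NEA Q c p ru mq N i = vG Q c p ru mq N := by
  have hsub : SE Q c p N ⊆ N := Finset.filter_subset _ _
  simp only [NEA]
  rw [Finset.sum_ite_mem, Finset.inter_eq_right.2 hsub, ← Finset.sum_mul, ← Finset.sum_div,
    div_self hΔ, one_mul]

/-- proportional essential rate rule. With `N^E ≠ ∅`, `Δ i > 0` for every
`i ∈ N^E`, `v(N) > 0`, `∑_{i ∈ N^E} Q i < mq`, a nonempty maximizer `D^N` of `G^N` over
subsets of `N^C`, nonnegative weights `α` on `D^N` with positive total, and
`0 ≤ ρ ≤ e(S, φ)/(∑_{i ∈ S} φ i)` for every proper coalition `S ⊊ N` with `S^E ≠ ∅`,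
the allocation `φ^ρ` (scaling essential players' NEA shares by `1 − ρ` and
redistributing `ρ v(N)` to `D^N` proportionally to `α`) lies in the core. -/
theorem proportional_essential_rate_in_core [DecidableEq ι]
    (N : Finset ι) (hN : N.Nonempty) (Q c : ι → ℝ) (p ru mq : ℝ)
    (hQ : ∀ i ∈ N, 0 < Q i) (hc : ∀ i ∈ N, 0 ≤ c i)
    (hp : 0 ≤ p) (hru : 0 ≤ ru) (hmq : 0 < mq)
    (hQmq : ∀ i ∈ N, Q i < mq)
    (hNE : (SE Q c p N).Nonempty)
    (hpos : ∀ i ∈ SE Q c p N, 0 < Dm Q c p i)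
    (hvN : 0 < vG Q c p ru mq N)
    (hbelow : ∑ i ∈ SE Q c p N, Q i < mq)
    (DN : Finset ι) (hDN : DN ⊆ SC Q c p ru N) (hDNne : DN.Nonempty)
    (hDNmax : ∀ D ⊆ SC Q c p ru N, GS Q c p ru mq N D ≤ GS Q c p ru mq N DN)
    (α : ι → ℝ) (hα : ∀ i ∈ DN, 0 ≤ α i) (hαpos : 0 < ∑ j ∈ DN, α j)
    (ρ : ℝ) (hρ0 : 0 ≤ ρ)
    (hρ : ∀ S, S ⊆ N → S ≠ N → (SE Q c p S).Nonempty →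
      ρ ≤ exc Q c p ru mq N S / (∑ i ∈ S, NEA Q c p ru mq N i))
    (φρ : ι → ℝ)
    (hφρ : ∀ i, φρ i =
      if i ∈ SE Q c p N then (1 - ρ) * NEA Q c p ru mq N i
      else if i ∈ DN then (α i / ∑ j ∈ DN, α j) * ρ * vG Q c p ru mq N
      else 0) :
    (∑ i ∈ N, φρ i = vG Q c p ru mq N) ∧
    ∀ S ⊆ N, vG Q c p ru mq S ≤ ∑ i ∈ S, φρ i := by
  have hΔpos : 0 < ∑ j ∈ SE Q c p N, Dm Q c p j := Finset.sum_pos hpos hNE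
  have hDE : ∀ i ∈ DN, i ∉ SE Q c p N := fun i hi => (Finset.mem_sdiff.1 (hDN hi)).2
  have hDN' : DN ⊆ N := fun i hi =>
    Finset.filter_subset _ _ (Finset.mem_sdiff.1 (hDN hi)).1
  have hNEApos : ∀ i ∈ SE Q c p N, 0 < NEA Q c p ru mq N i := fun i hi => by
    rw [NEA, if_pos hi]
    exact mul_pos (div_pos (hpos i hi) hΔpos) hvN
  have hNEA : ∀ i, 0 ≤ NEA Q c p ru mq N i := fun i => by
    by_cases hi : i ∈ SE Q c p N
    · exact (hNEApos i hi).le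
    · rw [NEA, if_neg hi]
  have hsplit : ∀ i, φρ i = (1 - ρ) * NEA Q c p ru mq N i +
      if i ∈ DN then (α i / ∑ j ∈ DN, α j) * ρ * vG Q c p ru mq N else 0 := fun i => by
    rw [hφρ]
    by_cases hi : i ∈ SE Q c p N
    · rw [if_pos hi, if_neg fun h => hDE i h hi, add_zero]
    · rw [if_neg hi, NEA, if_neg hi, mul_zero, zero_add]
  have hshare : ∀ i, 0 ≤ if i ∈ DN then (α i / ∑ j ∈ DN, α j) * ρ * vG Q c p ru mq N else 0 :=
    fun i => by
      split_ifs with hi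
      · exact mul_nonneg (mul_nonneg (div_nonneg (hα i hi) hαpos.le) hρ0) hvN.le
      · exact le_rfl
  have htotal : ∑ i ∈ N, φρ i = vG Q c p ru mq N := by
    simp only [hsplit]
    rw [Finset.sum_add_distrib, ← Finset.mul_sum, sum_NEA hΔpos.ne', Finset.sum_ite_mem,
      Finset.inter_eq_right.2 hDN', ← Finset.sum_mul, ← Finset.sum_mul, ← Finset.sum_div,
      div_self hαpos.ne']
    ring
  refine ⟨htotal, fun S hS => ?_⟩
  rcases (SE Q c p S).eq_empty_or_nonempty with hSE | hSE
  · refine (vG_nonpos_of_SE_eq_empty hru hSE).trans (Finset.sum_nonneg fun i hi => ?_)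
    have hi' : i ∉ SE Q c p N := fun h => by
      have : i ∈ SE Q c p S := Finset.mem_filter.2 ⟨hi, (Finset.mem_filter.1 h).2⟩
      simp [hSE] at this
    rw [hφρ, if_neg hi']
    exact hshare i
  · rcases eq_or_ne S N with rfl | hSN
    · exact htotal.ge
    have hφS : 0 < ∑ i ∈ S, NEA Q c p ru mq N i := by
      obtain ⟨i, hi⟩ := hSE
      obtain ⟨hiS, hiΔ⟩ := Finset.mem_filter.1 hi
      exact Finset.sum_pos' (fun i _ => hNEA i)
        ⟨i, hiS, hNEApos i (Finset.mem_filter.2 ⟨hS hiS, hiΔ⟩)⟩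
    have hbound := (le_div_iff₀ hφS).1 (hρ S hS hSN hSE)
    rw [exc] at hbound
    calc vG Q c p ru mq S ≤ (1 - ρ) * ∑ i ∈ S, NEA Q c p ru mq N i := by linarith
      _ = ∑ i ∈ S, (1 - ρ) * NEA Q c p ru mq N i := Finset.mul_sum _ _ _
      _ ≤ ∑ i ∈ S, φρ i := Finset.sum_le_sum fun i _ => by
        rw [hsplit]
        exact le_add_of_nonneg_right (hshare i)

end
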